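/- arXiv:1611.10140 — 6 statements merged into one kernel-verified Lean document; each statement's English description precedes it below -/
import Mathlib

section
/- For every fixed integer p ≥ 2 there exists Q such that for all integers q ≥ Q, the chromatic polynomial of the complete bipartite graph K_{p,q} has a non-real complex root z (i.e., Im(z) ≠ 0) with Re(z) > p. -/
/-- `P` is the chromatic polynomial of `G`: for every natural number `k`,
`P` evaluated at `k` equals the number of proper colorings of `G` with `k` colors. -/
def IsChromaticPoly {V : Type*} (G : SimpleGraph V) (P : Polynomial ℂ) : Prop :=
  ∀ k : ℕ, P.eval (k : ℂ) = Nat.card (G.Coloring (Fin k))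

open Polynomial Finset

/-! ### Counting colorings of complete bipartite graphs -/

/-- Maps from an `n`-element set grouped by the size of their image. -/
theorem sum_card_image_eq_sum_stirlingSecond (n k : ℕ) (g : ℕ → ℕ) :
    ∑ f : Fin n → Fin k, g (univ.image f).card =
      ∑ m ∈ range (n + 1), n.stirlingSecond m * k.descFactorial m * g m := by
  induction n generalizing g with
  | zero => simp
  | succ n ih =>
    have hcons : ∀ f : Fin n → Fin k,
        ∑ c : Fin k, g (univ.image (Fin.cons c f : Fin (n + 1) → Fin k)).card =
          (univ.image f).card * g (univ.image f).card
            + (k - (univ.image f).card) * g ((univ.image f).card + 1) := by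
      intro f
      have himage : ∀ c : Fin k, univ.image (Fin.cons c f : Fin (n + 1) → Fin k) =
          insert c (univ.image f) := by
        intro c
        ext d
        simp [Fin.exists_fin_succ, eq_comm]
      simp_rw [himage]
      rw [← Finset.sum_add_sum_compl (univ.image f)]
      congr 1
      · rw [Finset.sum_congr rfl fun c hc => by rw [Finset.insert_eq_of_mem hc]]
        simp
      · rw [Finset.sum_congr rfl fun c hc => by
          rw [Finset.card_insert_of_notMem (Finset.mem_compl.1 hc)]]
        simp [Finset.card_compl]
    rw [← (Fin.consEquiv fun _ => Fin k).sum_comp, Fintype.sum_prod_type, Finset.sum_comm]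
    simp only [Fin.consEquiv, Equiv.coe_fn_mk]
    rw [Finset.sum_congr rfl fun f _ => hcons f,
      ih fun m => m * g m + (k - m) * g (m + 1), Finset.sum_range_succ' _ (n + 1)]
    have hsplit : ∀ m, (n + 1).stirlingSecond (m + 1) * k.descFactorial (m + 1) * g (m + 1) =
        n.stirlingSecond (m + 1) * k.descFactorial (m + 1) * ((m + 1) * g (m + 1))
          + n.stirlingSecond m * k.descFactorial m * ((k - m) * g (m + 1)) := fun m => by
      rw [Nat.stirlingSecond_succ_succ, Nat.descFactorial_succ]
      ring
    simp only [hsplit, mul_add (_ * _), Finset.sum_add_distrib,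
      Nat.stirlingSecond_succ_zero, zero_mul, add_zero]
    congr 1
    rw [Finset.sum_range_succ' _ n, Finset.sum_range_succ _ n,
      Nat.stirlingSecond_eq_zero_of_lt (Nat.lt_succ_self n)]
    simp

/-- A coloring of a complete bipartite graph is a coloring of one side together with a coloring of
the other side avoiding the colors already used. -/
def completeBipartiteColoringEquiv (V W α : Type*) :
    (completeBipartiteGraph V W).Coloring α ≃
      Σ f : V → α, (W → {c : α // c ∉ Set.range f}) where
  toFun C := ⟨fun v => C (Sum.inl v), fun w => ⟨C (Sum.inr w), by
    rintro ⟨v, hv⟩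
    exact C.valid (v := Sum.inl v) (w := Sum.inr w) (by simp) hv⟩⟩
  invFun x := SimpleGraph.Coloring.mk (Sum.elim x.1 fun w => (x.2 w).1) (by
    rintro (v | v) (w | w) h
    · simp at h
    · exact fun he => (x.2 w).2 ⟨v, he⟩
    · exact fun he => (x.2 v).2 ⟨w, he.symm⟩
    · simp at h)
  left_inv C := by
    ext (v | w) <;> rfl
  right_inv x := rfl

theorem card_coloring_completeBipartiteGraph (p q k : ℕ) :
    Nat.card ((completeBipartiteGraph (Fin p) (Fin q)).Coloring (Fin k)) =
      ∑ m ∈ range (p + 1), p.stirlingSecond m * k.descFactorial m * (k - m) ^ q := by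
  classical
  rw [Nat.card_congr (completeBipartiteColoringEquiv _ _ _), Nat.card_sigma,
    ← sum_card_image_eq_sum_stirlingSecond p k fun m => (k - m) ^ q]
  refine Finset.sum_congr rfl fun f _ => ?_
  have hcard : Fintype.card {c : Fin k // c ∉ Set.range f} = k - (univ.image f).card := by
    rw [Fintype.card_subtype_compl, Fintype.card_fin]
    congr 1
    rw [Fintype.card_subtype]
    congr 1
    ext c
    simp
  simp [Nat.card_eq_fintype_card, hcard, -Set.mem_range]

theorem IsChromaticPoly.eval_completeBipartiteGraph {p q : ℕ} {P : ℂ[X]}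
    (hP : IsChromaticPoly (completeBipartiteGraph (Fin p) (Fin q)) P) (z : ℂ) :
    P.eval z = ∑ m ∈ range (p + 1),
      (p.stirlingSecond m : ℂ) * (∏ i ∈ range m, (z - i)) * (z - m) ^ q := by
  have heq : P = ∑ m ∈ range (p + 1),
      C (p.stirlingSecond m : ℂ) * (∏ i ∈ range m, (X - C (i : ℂ))) * (X - C (m : ℂ)) ^ q := by
    refine Polynomial.eq_of_infinite_eval_eq _ _
      ((Set.infinite_range_of_injective (Nat.cast_injective (R := ℂ))).mono ?_)
    rintro _ ⟨k, rfl⟩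
    have hdesc : ∀ m : ℕ, ∏ i ∈ range m, ((k : ℂ) - i) = (k.descFactorial m : ℂ) := by
      intro m
      rw [← descPochhammer_eval_eq_descFactorial, descPochhammer_eval_eq_prod_range]
    simp only [Set.mem_ofPred_eq, hP k, card_coloring_completeBipartiteGraph, Nat.cast_sum,
      Polynomial.eval_finsetSum, Polynomial.eval_mul, Polynomial.eval_prod, Polynomial.eval_pow,
      Polynomial.eval_sub, Polynomial.eval_X, Polynomial.eval_C, hdesc]
    refine Finset.sum_congr rfl fun m _ => ?_
    rcases lt_or_ge k m with hkm | hkm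
    · simp [Nat.descFactorial_of_lt hkm]
    · push_cast [Nat.cast_sub hkm]
      ring
  rw [heq]
  simp [Polynomial.eval_finsetSum, Polynomial.eval_prod]

/-- The chromatic polynomial of `K_{p,q}` has no real root greater than `p`. -/
theorem IsChromaticPoly.eval_ofReal_ne_zero {p q : ℕ} {P : ℂ[X]}
    (hP : IsChromaticPoly (completeBipartiteGraph (Fin p) (Fin q)) P) {x : ℝ} (hx : (p : ℝ) < x) :
    P.eval (x : ℂ) ≠ 0 := by
  have hpos : 0 < ∑ m ∈ range (p + 1),
      (p.stirlingSecond m : ℝ) * (∏ i ∈ range m, (x - i)) * (x - m) ^ q := by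
    have hlt : ∀ m ≤ p, 0 < x - m := fun m hm => by
      have : (m : ℝ) ≤ p := by exact_mod_cast hm
      linarith
    have hprod : ∀ m ≤ p, 0 < (∏ i ∈ range m, (x - i)) * (x - m) ^ q := fun m hm =>
      mul_pos (Finset.prod_pos fun i hi => hlt i ((Finset.mem_range.1 hi).le.trans hm))
        (pow_pos (hlt m hm) q)
    refine Finset.sum_pos' (fun m hm => ?_) ⟨p, by simp, ?_⟩
    · rw [mul_assoc]
      exact mul_nonneg (Nat.cast_nonneg _) (hprod m (by simpa [Nat.lt_succ_iff] using hm)).le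
    · rw [mul_assoc, Nat.stirlingSecond_self, Nat.cast_one, one_mul]
      exact hprod p le_rfl
  rw [hP.eval_completeBipartiteGraph]
  exact_mod_cast hpos.ne'

/-! ### Roots in a half-plane and power sums -/

/-- Newton's identities for the third power sum, in terms of `∏ (1 + y X)`. -/
theorem coeff_prod_one_add_C_mul_X {R : Type*} [CommRing R] (s : Multiset R) :
    (s.map fun y => 1 + C y * X).prod.coeff 0 = 1 ∧
    (s.map fun y => 1 + C y * X).prod.coeff 1 = s.sum ∧
    (s.map (· ^ 3)).sum =
      (s.map fun y => 1 + C y * X).prod.coeff 1 ^ 3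
        - 3 * (s.map fun y => 1 + C y * X).prod.coeff 1 * (s.map fun y => 1 + C y * X).prod.coeff 2
        + 3 * (s.map fun y => 1 + C y * X).prod.coeff 3 := by
  induction s using Multiset.induction with
  | empty => simp [Polynomial.coeff_one]
  | cons a s ih =>
    obtain ⟨h0, h1, h3⟩ := ih
    simp only [Multiset.map_cons, Multiset.prod_cons, Multiset.sum_cons, add_mul, one_mul,
      mul_assoc, Polynomial.coeff_add, Polynomial.coeff_C_mul, Polynomial.coeff_X_mul,
      Polynomial.coeff_X_mul_zero, h0, h3]
    refine ⟨by ring, by rw [h1]; ring, by ring⟩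

theorem sum_re_nonneg_and_sum_pow_three_re_le (s : Multiset ℂ) (hs : ∀ y ∈ s, 0 ≤ y.re) :
    0 ≤ s.sum.re ∧ (s.map (· ^ 3)).sum.re ≤ s.sum.re ^ 3 := by
  induction s using Multiset.induction with
  | empty => simp
  | cons a s ih =>
    obtain ⟨h0, h1⟩ := ih fun y hy => hs y (Multiset.mem_cons_of_mem hy)
    have ha := hs a (Multiset.mem_cons_self a s)
    simp only [Multiset.map_cons, Multiset.sum_cons, Complex.add_re]
    refine ⟨add_nonneg ha h0, ?_⟩
    have hcube : (a ^ 3).re = a.re ^ 3 - 3 * a.re * a.im ^ 2 := by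
      simp [pow_succ, Complex.mul_re, Complex.mul_im]
      ring
    have h2 : 0 ≤ a.re * a.im ^ 2 := mul_nonneg ha (sq_nonneg _)
    have h3 : 0 ≤ a.re * s.sum.re * (a.re + s.sum.re) := by positivity
    rw [hcube]
    nlinarith

theorem eq_prod_roots_one_add_C_mul_X (F : ℂ[X]) (h0 : F.coeff 0 = 1) :
    F = ((F.roots.map fun w => -w⁻¹).map fun y => 1 + C y * X).prod := by
  have hF : F ≠ 0 := by
    rintro rfl
    simp at h0
  have hsplit := (IsAlgClosed.splits F).eq_prod_roots
  have hfactor : ∀ w ∈ F.roots, X - C w = C (-w) * (1 + C (-w⁻¹) * X) := by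
    intro w hw
    have hw0 : w ≠ 0 := by
      rintro rfl
      rw [Polynomial.mem_roots hF, Polynomial.IsRoot, ← Polynomial.coeff_zero_eq_eval_zero, h0] at hw
      exact one_ne_zero hw
    rw [mul_add, ← mul_assoc, ← C_mul, neg_mul_neg, mul_inv_cancel₀ hw0]
    simp
    ring
  rw [Multiset.map_congr rfl hfactor, Multiset.prod_map_mul,
    Multiset.prod_hom' _ (C : ℂ →+* ℂ[X]), ← mul_assoc, ← C_mul] at hsplit
  have hcoeff := coeff_prod_one_add_C_mul_X (F.roots.map fun w => -w⁻¹)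
  rw [Multiset.map_map] at hcoeff ⊢
  simp only [Function.comp_def] at hcoeff ⊢
  have hconst : F.leadingCoeff * (F.roots.map fun w => -w).prod = 1 := by
    have := congrArg (fun G : ℂ[X] => G.coeff 0) hsplit
    simp only [h0, Polynomial.coeff_C_mul, hcoeff.1, mul_one] at this
    exact this.symm
  rw [hconst] at hsplit
  simpa using hsplit

/-- A polynomial `1 + a X + b X² + c X³ + ⋯` with `a b < c` has a root in the open right
half-plane. -/
theorem exists_root_re_pos_of_coeff (F : ℂ[X]) (a b c : ℝ) (h0 : F.coeff 0 = 1)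
    (h1 : F.coeff 1 = a) (h2 : F.coeff 2 = b) (h3 : F.coeff 3 = c) (h : a * b < c) :
    ∃ w : ℂ, F.eval w = 0 ∧ 0 < w.re := by
  by_contra! hneg
  have hF : F ≠ 0 := by
    rintro rfl
    simp at h0
  have hprod := eq_prod_roots_one_add_C_mul_X F h0
  set s := F.roots.map fun w => -w⁻¹ with hs_def
  have hs : ∀ y ∈ s, 0 ≤ y.re := by
    intro y hy
    obtain ⟨w, hw, rfl⟩ := Multiset.mem_map.1 hy
    have := hneg w ((Polynomial.mem_roots hF).1 hw)
    rw [Complex.neg_re, Complex.inv_re, ← neg_div]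
    exact div_nonneg (by linarith) (Complex.normSq_nonneg _)
  obtain ⟨-, hsum, hcube⟩ := coeff_prod_one_add_C_mul_X s
  rw [← hprod] at hsum hcube
  have hle := (sum_re_nonneg_and_sum_pow_three_re_le s hs).2
  rw [hcube, ← hsum, h1, h2, h3] at hle
  have hre : ((a : ℂ) ^ 3 - 3 * a * b + 3 * c).re = a ^ 3 - 3 * a * b + 3 * c := by
    rw [← Complex.ofReal_re (a ^ 3 - 3 * a * b + 3 * c)]
    push_cast
    rfl
  rw [hre, Complex.ofReal_re] at hle
  linarith

/-! ### The chromatic polynomial expanded around infinity -/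

/-- The factor of `revChromatic` that does not depend on the size of the second part. -/
noncomputable def revChromaticFactor (p j : ℕ) : ℕ[X] :=
  C (p.stirlingSecond (p - j)) * ∏ i ∈ range (p - j), (1 + C (p - i) * X)

/-- The polynomial `w ^ (p + q) π(K_{p,q}, p + 1 / w)`. -/
noncomputable def revChromatic (p q : ℕ) : ℕ[X] :=
  ∑ j ∈ range (p + 1), X ^ j * (revChromaticFactor p j * (1 + C j * X) ^ q)

theorem IsChromaticPoly.pow_mul_eval {p q : ℕ} {P : ℂ[X]}
    (hP : IsChromaticPoly (completeBipartiteGraph (Fin p) (Fin q)) P) {w : ℂ} (hw : w ≠ 0) :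
    w ^ (p + q) * P.eval (p + w⁻¹) =
      ((revChromatic p q).map (Nat.castRingHom ℂ)).eval w := by
  rw [hP.eval_completeBipartiteGraph, Finset.mul_sum, ← Finset.sum_range_reflect, revChromatic,
    Polynomial.map_sum, Polynomial.eval_finsetSum]
  refine Finset.sum_congr rfl fun j hj => ?_
  have hj' : j ≤ p := by simpa [Nat.lt_succ_iff] using hj
  have hfac : ∀ i ≤ p, (1 + ((p - i : ℕ) : ℂ) * w) = w * (p + w⁻¹ - i) := by
    intro i hi
    rw [Nat.cast_sub hi]
    field_simp
    ring
  have hprod : ∏ i ∈ range (p - j), (1 + ((p - i : ℕ) : ℂ) * w) =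
      w ^ (p - j) * ∏ i ∈ range (p - j), (p + w⁻¹ - i) := by
    rw [Finset.prod_congr rfl fun i hi => hfac i (by have := Finset.mem_range.1 hi; omega),
      Finset.prod_mul_distrib, Finset.prod_const, Finset.card_range]
  have hlast := hfac (p - j) (Nat.sub_le _ _)
  rw [Nat.sub_sub_self hj'] at hlast
  have hpow : w ^ (p + q) = w ^ j * w ^ (p - j) * w ^ q := by
    rw [← pow_add, ← pow_add]
    congr 1
    omega
  simp only [revChromaticFactor, Polynomial.map_mul, Polynomial.map_pow, Polynomial.map_X,
    Polynomial.map_add, Polynomial.map_one, Polynomial.map_C, Polynomial.map_prod,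
    Polynomial.eval_mul, Polynomial.eval_pow, Polynomial.eval_X, Polynomial.eval_add,
    Polynomial.eval_one, Polynomial.eval_C, Polynomial.eval_prod, Nat.coe_castRingHom,
    hprod, hlast, add_tsub_cancel_right, hpow, mul_pow]
  ring

theorem coeff_zero_revChromaticFactor (p j : ℕ) :
    (revChromaticFactor p j).coeff 0 = p.stirlingSecond (p - j) := by
  simp [revChromaticFactor, Polynomial.coeff_zero_eq_eval_zero, Polynomial.eval_prod]

theorem coeff_revChromatic {p : ℕ} (hp : 2 ≤ p) (q : ℕ) :
    (revChromatic p q).coeff 0 = 1 ∧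
    (revChromatic p q).coeff 1 =
      (revChromaticFactor p 0).coeff 1 + (revChromaticFactor p 1).coeff 0 ∧
    (revChromatic p q).coeff 2 =
      (revChromaticFactor p 0).coeff 2 + (revChromaticFactor p 1).coeff 1
        + (revChromaticFactor p 2).coeff 0 + (revChromaticFactor p 1).coeff 0 * q := by
  obtain ⟨r, rfl⟩ := Nat.exists_eq_add_of_le' hp
  have htail : ∀ d < 3, (∑ j ∈ range r, X ^ (j + 1 + 1 + 1) *
      (revChromaticFactor (r + 2) (j + 1 + 1 + 1) *
        (1 + C (j + 1 + 1 + 1) * X) ^ q) : ℕ[X]).coeff d = 0 := by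
    intro d hd
    rw [Polynomial.finsetSum_coeff]
    refine Finset.sum_eq_zero fun j _ => ?_
    rw [Polynomial.coeff_X_pow_mul', if_neg (by omega)]
  have hone : ((1 + X : ℕ[X]) ^ q).coeff 0 = 1 := by simp [Polynomial.coeff_one_add_X_pow]
  have hone' : ((1 + X : ℕ[X]) ^ q).coeff 1 = q := by simp [Polynomial.coeff_one_add_X_pow]
  have htwo : ((1 + 2 * X : ℕ[X]) ^ q).coeff 0 = 1 := by
    simp [Polynomial.coeff_zero_eq_eval_zero]
  rw [revChromatic, Finset.sum_range_succ', Finset.sum_range_succ', Finset.sum_range_succ']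
  refine ⟨?_, ?_, ?_⟩
  · rw [Polynomial.coeff_add, Polynomial.coeff_add, Polynomial.coeff_add, htail 0 (by norm_num)]
    simp [coeff_zero_revChromaticFactor, Nat.stirlingSecond_self]
  · rw [Polynomial.coeff_add, Polynomial.coeff_add, Polynomial.coeff_add, htail 1 (by norm_num)]
    simp [Polynomial.coeff_X_pow_mul', Polynomial.mul_coeff_zero, hone]
    ring
  · rw [Polynomial.coeff_add, Polynomial.coeff_add, Polynomial.coeff_add, htail 2 (by norm_num)]
    simp [Polynomial.coeff_X_pow_mul', Polynomial.mul_coeff_zero, Polynomial.mul_coeff_one, hone,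
      hone', htwo]
    ring

theorem choose_two_le_coeff_three_revChromatic {p : ℕ} (hp : 2 ≤ p) (q : ℕ) :
    q.choose 2 ≤ (revChromatic p q).coeff 3 := by
  rw [revChromatic, Polynomial.finsetSum_coeff]
  refine le_trans ?_ (Finset.single_le_sum (fun _ _ => Nat.zero_le _)
    (show 1 ∈ range (p + 1) by simp; omega))
  have hpos : 1 ≤ (revChromaticFactor p 1).coeff 0 := by
    rw [coeff_zero_revChromaticFactor]
    obtain ⟨r, rfl⟩ := Nat.exists_eq_add_of_le' (show 1 ≤ p by omega)
    rw [Nat.add_sub_cancel, Nat.stirlingSecond_succ_self_left]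
    exact Nat.choose_pos hp
  rw [Polynomial.coeff_X_pow_mul', if_pos (by norm_num), Polynomial.coeff_mul]
  refine le_trans ?_ (Finset.single_le_sum (fun _ _ => Nat.zero_le _)
    (show (0, 2) ∈ antidiagonal (3 - 1) by simp))
  simpa [Polynomial.coeff_one_add_X_pow] using Nat.le_mul_of_pos_left (q.choose 2) hpos

theorem exists_forall_mul_add_lt_choose_two (a b c : ℕ) :
    ∃ Q : ℕ, ∀ q ≥ Q, a * (b + c * q) < q.choose 2 := by
  refine ⟨2 * a * (b + c) + 2, fun q hq => ?_⟩
  obtain ⟨r, rfl⟩ := Nat.exists_eq_add_of_le' (show 1 ≤ q by omega)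
  have h2 : (r + 1) * r = (r + 1).choose 2 * 2 := by
    simpa using Nat.add_one_mul_choose_eq r 1
  have hr : (r + 1) * (2 * a * (b + c) + 1) ≤ (r + 1) * r := Nat.mul_le_mul_left _ (by omega)
  have hb : a * b ≤ a * b * (r + 1) := Nat.le_mul_of_pos_right _ (Nat.succ_pos r)
  nlinarith

/-- For every fixed integer `p ≥ 2` there exists `Q` such that for all `q ≥ Q`, the chromatic
polynomial of the complete bipartite graph `K_{p,q}` has a non-real root `z` with `Re z > p`. -/
theorem exists_nonreal_chromatic_root_re_gt_of_completeBipartite (p : ℕ) (hp : 2 ≤ p) :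
    ∃ Q : ℕ, ∀ q : ℕ, Q ≤ q →
      ∀ P : Polynomial ℂ, IsChromaticPoly (completeBipartiteGraph (Fin p) (Fin q)) P →
        ∃ z : ℂ, P.eval z = 0 ∧ z.im ≠ 0 ∧ (p : ℝ) < z.re := by
  obtain ⟨Q, hQ⟩ := exists_forall_mul_add_lt_choose_two
    ((revChromaticFactor p 0).coeff 1 + (revChromaticFactor p 1).coeff 0)
    ((revChromaticFactor p 0).coeff 2 + (revChromaticFactor p 1).coeff 1
      + (revChromaticFactor p 2).coeff 0)
    ((revChromaticFactor p 1).coeff 0)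
  refine ⟨Q, fun q hq P hP => ?_⟩
  obtain ⟨h0, h1, h2⟩ := coeff_revChromatic hp q
  have hlt := (hQ q hq).trans_le (choose_two_le_coeff_three_revChromatic hp q)
  rw [← h1, ← h2] at hlt
  obtain ⟨w, hw, hwre⟩ := exists_root_re_pos_of_coeff
    ((revChromatic p q).map (Nat.castRingHom ℂ))
    ((revChromatic p q).coeff 1) ((revChromatic p q).coeff 2) ((revChromatic p q).coeff 3)
    (by simp [h0]) (by simp) (by simp) (by simp) (by exact_mod_cast hlt)
  have hw0 : w ≠ 0 := by
    rintro rfl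
    simp at hwre
  have hroot : P.eval (p + w⁻¹) = 0 := by
    rw [← hP.pow_mul_eval hw0] at hw
    exact (mul_eq_zero.1 hw).resolve_left (pow_ne_zero _ hw0)
  have hre : (p : ℝ) < ((p : ℂ) + w⁻¹).re := by
    rw [Complex.add_re, Complex.natCast_re, Complex.inv_re]
    exact lt_add_of_pos_right _ (div_pos hwre (Complex.normSq_pos.2 hw0))
  refine ⟨p + w⁻¹, hroot, fun him => ?_, hre⟩
  refine hP.eval_ofReal_ne_zero hre ?_
  rwa [show ((((p : ℂ) + w⁻¹).re : ℝ) : ℂ) = p + w⁻¹ from Complex.ext rfl (by simpa using him.symm)]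
end

section
/- Let G be a finite simple graph of order n with chromatic number χ(G) = n − 2. Then every chromatic root z of G satisfies Re(z) < n − 1. -/
/-- The number of proper colorings of `G` using every one of `j` given colors. -/
noncomputable def SimpleGraph.surjColoringCount {V : Type*} (G : SimpleGraph V) (j : ℕ) : ℕ :=
  Nat.card {f : G.Coloring (Fin j) // Function.Surjective f}

namespace SimpleGraph

variable {V : Type*} (G : SimpleGraph V)

/-- Colorings with image exactly `S` correspond to surjective colorings with `#S` colors. -/
noncomputable def coloringRangeEquiv {k : ℕ} (S : Finset (Fin k)) :
    {f : G.Coloring (Fin k) // Set.range f = S} ≃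
      {f : G.Coloring (Fin S.card) // Function.Surjective f} where
  toFun f := ⟨Coloring.mk
      (fun v => S.equivFin ⟨f.1 v, by
        have h : f.1 v ∈ Set.range f.1 := ⟨v, rfl⟩
        rw [f.2] at h
        exact h⟩)
      (fun {v w} hvw h => f.1.valid hvw (by simpa using h)), by
    intro c
    have h : ((S.equivFin.symm c : S) : Fin k) ∈ Set.range f.1 := by
      rw [f.2]
      exact (S.equivFin.symm c).2
    obtain ⟨v, hv⟩ := h
    refine ⟨v, ?_⟩
    change S.equivFin ⟨f.1 v, _⟩ = c
    rw [← Equiv.eq_symm_apply]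
    exact Subtype.ext hv⟩
  invFun g := ⟨Coloring.mk (fun v => ((S.equivFin.symm (g.1 v) : S) : Fin k))
      (fun {v w} hvw h => g.1.valid hvw (by simpa [Subtype.ext_iff] using h)), by
    ext c
    constructor
    · rintro ⟨v, rfl⟩
      exact (S.equivFin.symm (g.1 v)).2
    · intro hc
      obtain ⟨v, hv⟩ := g.2 (S.equivFin ⟨c, hc⟩)
      refine ⟨v, ?_⟩
      change ((S.equivFin.symm (g.1 v) : S) : Fin k) = c
      rw [hv, Equiv.symm_apply_apply]⟩
  left_inv f := by
    apply Subtype.ext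
    apply DFunLike.ext
    intro v
    change ((S.equivFin.symm (S.equivFin ⟨f.1 v, _⟩) : S) : Fin k) = f.1 v
    rw [Equiv.symm_apply_apply]
  right_inv g := by
    apply Subtype.ext
    apply DFunLike.ext
    intro v
    exact S.equivFin.apply_symm_apply (g.1 v)

theorem card_coloring_eq_sum_choose_mul [Finite V] (k : ℕ) :
    Nat.card (G.Coloring (Fin k)) =
      ∑ j ∈ Finset.range (k + 1), k.choose j * G.surjColoringCount j := by
  classical
  have : Finite (G.Coloring (Fin k)) := DFunLike.finite _
  let e : G.Coloring (Fin k) ≃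
      Σ S : Finset (Fin k), {f : G.Coloring (Fin k) // Set.range f = S} :=
    ((Equiv.sigmaFiberEquiv fun f : G.Coloring (Fin k) => (Set.range f).toFinset).symm).trans
      (Equiv.sigmaCongrRight fun S => Equiv.subtypeEquivRight fun f => by
        rw [← Finset.coe_inj, Set.coe_toFinset])
  rw [Nat.card_congr e, Nat.card_sigma]
  simp_rw [Nat.card_congr (G.coloringRangeEquiv _)]
  have h := Finset.sum_powerset_apply_card G.surjColoringCount (x := (Finset.univ : Finset (Fin k)))
  simpa [surjColoringCount] using h

theorem surjColoringCount_eq_zero_of_not_colorable {j : ℕ} (h : ¬ G.Colorable j) :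
    G.surjColoringCount j = 0 := by
  have : IsEmpty {f : G.Coloring (Fin j) // Function.Surjective f} := ⟨fun f => h ⟨f.1⟩⟩
  exact Nat.card_of_isEmpty

theorem surjColoringCount_eq_zero_of_card_lt [Fintype V] {j : ℕ} (h : Fintype.card V < j) :
    G.surjColoringCount j = 0 := by
  have : IsEmpty {f : G.Coloring (Fin j) // Function.Surjective f} :=
    ⟨fun f => by
      have := Fintype.card_le_of_surjective f.1 f.2
      rw [Fintype.card_fin] at this
      omega⟩
  exact Nat.card_of_isEmpty

theorem surjColoringCount_card_pos [Fintype V] : 0 < G.surjColoringCount (Fintype.card V) := by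
  have : Finite (G.Coloring (Fin (Fintype.card V))) := DFunLike.finite _
  have e := Fintype.equivFin V
  have : Nonempty {f : G.Coloring (Fin (Fintype.card V)) // Function.Surjective f} :=
    ⟨⟨Coloring.mk e (fun {v w} hvw h => hvw.ne (e.injective h)), e.surjective⟩⟩
  exact Nat.card_pos

theorem card_coloring_eq_of_card_eq_add_two [Fintype V] {m : ℕ} (hV : Fintype.card V = m + 2)
    (hm : ∀ j < m, ¬ G.Colorable j) (k : ℕ) :
    Nat.card (G.Coloring (Fin k)) = k.choose m * G.surjColoringCount m +
      k.choose (m + 1) * G.surjColoringCount (m + 1) +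
      k.choose (m + 2) * G.surjColoringCount (m + 2) := by
  have h₁ : ∑ j ∈ Finset.range (k + 1), k.choose j * G.surjColoringCount j =
      ∑ j ∈ Finset.range (k + m + 3), k.choose j * G.surjColoringCount j :=
    Finset.sum_subset (Finset.range_subset_range.2 (by omega)) fun j _ hj => by
      rw [Nat.choose_eq_zero_of_lt (by simpa using hj), zero_mul]
  have h₂ : ∑ j ∈ ({m, m + 1, m + 2} : Finset ℕ), k.choose j * G.surjColoringCount j =
      ∑ j ∈ Finset.range (k + m + 3), k.choose j * G.surjColoringCount j :=
    Finset.sum_subset (by intro j; simp; omega) fun j _ hj => by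
      simp only [Finset.mem_insert, Finset.mem_singleton, not_or] at hj
      rcases lt_or_ge j m with h | h
      · rw [G.surjColoringCount_eq_zero_of_not_colorable (hm j h), mul_zero]
      · rw [G.surjColoringCount_eq_zero_of_card_lt (by omega), mul_zero]
  rw [card_coloring_eq_sum_choose_mul, h₁, ← h₂]
  simp [add_assoc]

end SimpleGraph

theorem Complex.re_neg_of_quadratic_eq_zero {a b c : ℝ} (ha : 0 < a) (hb : 0 < b) (hc : 0 < c)
    {y : ℂ} (h : a * y ^ 2 + b * y + c = 0) : y.re < 0 := by
  have hre := congrArg Complex.re h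
  have him := congrArg Complex.im h
  simp [pow_two] at hre him
  by_contra! hy
  have him' : y.im * (2 * a * y.re + b) = 0 := by linarith
  rcases mul_eq_zero.1 him' with h0 | h0
  · rw [h0] at hre
    nlinarith [mul_nonneg ha.le (mul_nonneg hy hy), mul_nonneg hb.le hy]
  · nlinarith [mul_nonneg ha.le hy]

open Polynomial in
theorem Polynomial.eq_of_eval_natCast_eq {p q : ℂ[X]}
    (h : ∀ k : ℕ, p.eval (k : ℂ) = q.eval (k : ℂ)) : p = q :=
  Polynomial.eq_of_infinite_eval_eq p q <|
    (Set.infinite_range_of_injective (Nat.cast_injective (R := ℂ))).mono <| by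
      rintro _ ⟨k, rfl⟩
      exact h k

theorem choose_mul_eq_div_factorial_mul_eval_descPochhammer (k j s : ℕ) :
    ((k.choose j * s : ℕ) : ℂ) =
      ((s / j.factorial : ℝ) : ℂ) * (descPochhammer ℂ j).eval (k : ℂ) := by
  have hj : (j.factorial : ℂ) ≠ 0 := by exact_mod_cast j.factorial_ne_zero
  rw [descPochhammer_eval_eq_descFactorial, Nat.descFactorial_eq_factorial_mul_choose]
  push_cast
  field_simp

/-- If `G` is a finite simple graph of order `n` with chromatic number `χ(G) = n - 2`, then
every chromatic root `z` of `G` satisfies `Re z < n - 1`. -/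
theorem chromatic_root_re_lt_of_chromaticNumber_eq_sub_two {V : Type*} [Fintype V]
    (G : SimpleGraph V) (n : ℕ) (hn : n = Fintype.card V)
    (hχ : G.chromaticNumber = ((n - 2 : ℕ) : ℕ∞))
    (P : Polynomial ℂ) (hP : IsChromaticPoly G P) :
    ∀ z : ℂ, P.eval z = 0 → z.re < (n : ℝ) - 1 := by
  intro z hz
  have hcol : G.Colorable (n - 2) := SimpleGraph.chromaticNumber_le_iff_colorable.1 hχ.le
  have hmin : ∀ j < n - 2, ¬ G.Colorable j := fun j hj h => by
    have := SimpleGraph.chromaticNumber_le_iff_colorable.2 h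
    rw [hχ] at this
    exact absurd (Nat.cast_le.1 this) (by omega)
  rcases lt_or_ge n 2 with hn2 | hn2
  · rw [show n - 2 = 0 by omega] at hcol
    have hV : IsEmpty V := SimpleGraph.colorable_zero_iff.1 hcol
    have hP1 : P = 1 := Polynomial.eq_of_eval_natCast_eq fun k => by
      have : Nat.card (G.Coloring (Fin k)) = 1 :=
        Nat.card_eq_one_iff_unique.2
          ⟨⟨fun f g => DFunLike.ext _ _ fun v => hV.elim v⟩, ⟨SimpleGraph.Coloring.ofIsEmpty⟩⟩
      rw [hP k, this]
      simp
    simp [hP1] at hz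
  · obtain ⟨m, rfl⟩ : ∃ m, n = m + 2 := ⟨n - 2, by omega⟩
    simp only [Nat.add_sub_cancel] at hcol hmin
    have hcard := G.card_coloring_eq_of_card_eq_add_two hn.symm hmin
    have hpos₀ : 0 < G.surjColoringCount m := by
      have : Finite (G.Coloring (Fin m)) := DFunLike.finite _
      have : Nonempty (G.Coloring (Fin m)) := hcol
      have h : 0 < Nat.card (G.Coloring (Fin m)) := Nat.card_pos
      rw [hcard] at h
      simpa [Nat.choose_eq_zero_of_lt (show m < m + 2 by omega)] using h
    have hpos₂ : 0 < G.surjColoringCount (m + 2) := hn ▸ G.surjColoringCount_card_pos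
    set b : ℝ := G.surjColoringCount m / m.factorial
    set c : ℝ := G.surjColoringCount (m + 1) / (m + 1).factorial
    set a : ℝ := G.surjColoringCount (m + 2) / (m + 2).factorial
    have hb : 0 < b := by positivity
    have hc : 0 ≤ c := by positivity
    have ha : 0 < a := by positivity
    have hPeq : P = Polynomial.C (b : ℂ) * descPochhammer ℂ m +
        Polynomial.C (c : ℂ) * descPochhammer ℂ (m + 1) +
        Polynomial.C (a : ℂ) * descPochhammer ℂ (m + 2) :=
      Polynomial.eq_of_eval_natCast_eq fun k => by
        rw [hP k, hcard k, Nat.cast_add, Nat.cast_add]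
        simp only [choose_mul_eq_div_factorial_mul_eval_descPochhammer, Polynomial.eval_add,
          Polynomial.eval_mul, Polynomial.eval_C]
        rfl
    have hfac : (descPochhammer ℂ m).eval z *
        ((a : ℂ) * (z - (m + 1)) ^ 2 + ((a + c : ℝ) : ℂ) * (z - (m + 1)) + ((b + c : ℝ) : ℂ))
          = 0 := by
      rw [← hz, hPeq]
      simp only [Polynomial.eval_add, Polynomial.eval_mul, Polynomial.eval_C,
        descPochhammer_succ_eval]
      push_cast
      ring
    rcases mul_eq_zero.1 hfac with h | h
    · rw [descPochhammer_eval_eq_prod_range, Finset.prod_eq_zero_iff] at h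
      obtain ⟨j, hj, hzj⟩ := h
      have hjm : (j : ℝ) < m := by exact_mod_cast Finset.mem_range.1 hj
      rw [sub_eq_zero.1 hzj, Complex.natCast_re]
      push_cast
      linarith
    · have := Complex.re_neg_of_quadratic_eq_zero ha (by positivity) (by positivity) h
      simp at this
      push_cast
      linarith
end

section
/- Let G be a finite simple graph of order n with chromatic number χ(G) = n − 3. Then every chromatic root z of G satisfies Re(z) < n − 1. -/
/-- Polynomials over `ℂ` that agree at all natural numbers are equal. -/
theorem Polynomial.eq_of_eval_natCast_eq_s4 {P Q : Polynomial ℂ}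
    (h : ∀ k : ℕ, P.eval (k : ℂ) = Q.eval (k : ℂ)) : P = Q := by
  refine Polynomial.eq_of_infinite_eval_eq P Q ?_
  refine (Set.infinite_range_of_injective (Nat.cast_injective (R := ℂ))).mono ?_
  rintro _ ⟨k, rfl⟩
  exact h k

theorem descPochhammer_succ_eval_complex (n : ℕ) (z : ℂ) :
    (descPochhammer ℂ (n + 1)).eval z = (descPochhammer ℂ n).eval z * (z - n) := by
  simp [descPochhammer_succ_right]

/-- The roots of the falling factorial `(x)ₙ` are among `0, …, n - 1`. -/
theorem exists_natCast_eq_of_descPochhammer_eval_eq_zero {n : ℕ} {z : ℂ}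
    (h : (descPochhammer ℂ n).eval z = 0) : ∃ j < n, z = j := by
  induction n with
  | zero => simp at h
  | succ n ih =>
    rw [descPochhammer_succ_eval_complex, mul_eq_zero] at h
    rcases h with h | h
    · obtain ⟨j, hj, rfl⟩ := ih h
      exact ⟨j, hj.trans n.lt_succ_self, rfl⟩
    · exact ⟨n, n.lt_succ_self, sub_eq_zero.mp h⟩

/-- The Routh–Hurwitz criterion for real monic cubics: sufficiency. -/
theorem re_neg_of_cubic_eq_zero {A B C : ℝ} (hA : 0 < A) (hB : 0 < B) (hC : 0 < C)
    (hABC : C < A * B) {y : ℂ} (hy : y ^ 3 + A * y ^ 2 + B * y + C = 0) : y.re < 0 := by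
  obtain ⟨u, v⟩ := y
  have hre := congrArg Complex.re hy
  have him := congrArg Complex.im hy
  simp only [pow_succ, pow_zero, one_mul, Complex.add_re, Complex.add_im, Complex.mul_re,
    Complex.mul_im, Complex.ofReal_re, Complex.ofReal_im, Complex.zero_re, Complex.zero_im]
    at hre him
  by_contra! hu
  change 0 ≤ u at hu
  have hu2 : 0 ≤ u ^ 2 := sq_nonneg u
  have hu3 : 0 ≤ u ^ 3 := pow_nonneg hu 3
  have hAu : 0 ≤ A * u ^ 2 := by positivity
  have hBu : 0 ≤ B * u := by positivity
  have hAAu : 0 ≤ A ^ 2 * u := by positivity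
  rcases eq_or_ne v 0 with rfl | hv
  · linarith
  · have hv2 : v ^ 2 = 3 * u ^ 2 + 2 * A * u + B := by
      apply mul_left_cancel₀ hv
      linarith
    have hsub : u ^ 3 - 3 * u * v ^ 2 + A * (u ^ 2 - v ^ 2) + B * u + C = 0 := by linarith
    rw [hv2] at hsub
    linarith

namespace Setoid

variable {V : Type*}

/-- The maps with kernel `s` correspond to the embeddings of the quotient by `s`. -/
noncomputable def kerEqEquivEmbedding (s : Setoid V) (α : Type*) :
    {f : V → α // ker f = s} ≃ (Quotient s ↪ α) where
  toFun f := ⟨Quotient.lift f.1 fun a b h => by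
      have h' : ker f.1 a b := by rw [f.2]; exact h
      exact h', by
    rintro ⟨a⟩ ⟨b⟩ h
    have h' : ker f.1 a b := h
    rw [f.2] at h'
    exact Quotient.sound h'⟩
  invFun e := ⟨fun v => e (Quotient.mk s v), by
    ext a b
    exact e.injective.eq_iff.trans Quotient.eq⟩
  left_inv _ := rfl
  right_inv e := by
    ext ⟨a⟩
    rfl

variable [Fintype V]

open scoped Classical in
noncomputable instance : Fintype (Setoid V) :=
  Fintype.ofInjective (fun s a b => s a b) fun _ _ h =>
    Setoid.ext fun a b => iff_of_eq (congrFun (congrFun h a) b)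

theorem natCard_quotient_le (s : Setoid V) : Nat.card (Quotient s) ≤ Fintype.card V :=
  Nat.card_eq_fintype_card (α := V) ▸
    Nat.card_le_card_of_surjective (Quotient.mk s) Quotient.mk_surjective

theorem natCard_quotient_eq_card_iff (s : Setoid V) :
    Nat.card (Quotient s) = Fintype.card V ↔ s = ⊥ := by
  rw [← Nat.card_eq_fintype_card]
  constructor
  · intro h
    have hbij := (Nat.bijective_iff_surjective_and_card (Quotient.mk s)).2
      ⟨Quotient.mk_surjective, h.symm⟩
    rw [eq_bot_iff]
    intro a b hab
    exact hbij.injective (Quotient.sound hab)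
  · rintro rfl
    exact (Nat.card_eq_of_bijective (Quotient.mk (⊥ : Setoid V))
      ⟨fun a b h => Quotient.exact h, Quotient.mk_surjective⟩).symm

/-- A setoid relating two distinct points is the join of a setoid identifying just one pair of
points and a setoid with one more class. -/
theorem exists_sup_eq_of_ne_bot {s : Setoid V} (hs : s ≠ ⊥) :
    ∃ p q : Setoid V, p ⊔ q = s ∧ Nat.card (Quotient p) + 1 = Fintype.card V ∧
      Nat.card (Quotient q) = Nat.card (Quotient s) + 1 := by
  classical
  obtain ⟨x, y, hxy, hne⟩ : ∃ x y, s x y ∧ x ≠ y := by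
    by_contra! h
    exact hs (eq_bot_iff.mpr fun a b hab => h a b hab)
  let f : V → {v : V // v ≠ x} := fun a => if h : a = x then ⟨y, hne.symm⟩ else ⟨a, h⟩
  let g : V → Option (Quotient s) := fun a => if a = x then none else some (Quotient.mk s a)
  have hf : Function.Surjective f := fun ⟨a, ha⟩ => ⟨a, by simp [f, ha]⟩
  have hg : Function.Surjective g := by
    rintro (_ | c)
    · exact ⟨x, by simp [g]⟩
    · obtain ⟨a, rfl⟩ := Quotient.mk_surjective c
      by_cases ha : a = x
      · refine ⟨y, ?_⟩
        subst ha
        simp only [g, hne.symm, if_false]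
        exact congrArg some (Quotient.sound (s.symm hxy))
      · exact ⟨a, by simp only [g, ha, if_false]⟩
  have hfxy : ker f x y := by simp [ker_def, f, hne.symm]
  refine ⟨ker f, ker g, le_antisymm (sup_le ?_ ?_) ?_, ?_, ?_⟩
  · intro a b hab
    have hab' : f a = f b := hab
    by_cases ha : a = x <;> by_cases hb : b = x <;> simp [f, ha, hb] at hab'
    · rw [ha, hb]
    · rw [ha, ← hab']; exact hxy
    · rw [hb, hab']; exact s.symm hxy
    · rw [hab']
  · intro a b hab
    have hab' : g a = g b := hab
    by_cases ha : a = x <;> by_cases hb : b = x <;> simp [g, ha, hb] at hab'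
    · rw [ha, hb]
    · exact Quotient.exact hab'
  · have hcollapse : ∀ a, ∃ a', a' ≠ x ∧ s a a' ∧ (ker f ⊔ ker g) a a' := by
      intro a
      by_cases ha : a = x
      · subst ha
        exact ⟨y, hne.symm, hxy, (le_sup_left : ker f ≤ ker f ⊔ ker g) hfxy⟩
      · exact ⟨a, ha, s.refl a, (ker f ⊔ ker g).refl a⟩
    intro a b hab
    obtain ⟨a', ha', hsa, hja⟩ := hcollapse a
    obtain ⟨b', hb', hsb, hjb⟩ := hcollapse b
    have hs' : s a' b' := s.trans (s.symm hsa) (s.trans hab hsb)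
    have hgab : ker g a' b' := by
      simp only [ker_def, g, ha', hb', if_false]
      exact congrArg some (Quotient.sound hs')
    exact (ker f ⊔ ker g).trans hja ((ker f ⊔ ker g).trans
      ((le_sup_right : ker g ≤ ker f ⊔ ker g) hgab) ((ker f ⊔ ker g).symm hjb))
  · rw [Nat.card_congr (quotientKerEquivOfSurjective f hf), Nat.card_eq_fintype_card,
      Fintype.card_subtype_compl, Fintype.card_subtype_eq]
    exact Nat.sub_add_cancel (Fintype.card_pos_iff.mpr ⟨x⟩)
  · rw [Nat.card_congr (quotientKerEquivOfSurjective g hg), Finite.card_option]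

end Setoid

namespace SimpleGraph

variable {V : Type*} (G : SimpleGraph V)

/-- A setoid is independent for `G` if each of its classes is an independent set of `G`. -/
def IsIndepSetoid (s : Setoid V) : Prop :=
  ∀ ⦃u v : V⦄, G.Adj u v → ¬ s u v

variable {G}

theorem IsIndepSetoid.mono {s t : Setoid V} (ht : G.IsIndepSetoid t) (h : s ≤ t) :
    G.IsIndepSetoid s :=
  fun _ _ huv hs => ht huv (h hs)

theorem isIndepSetoid_bot : G.IsIndepSetoid ⊥ :=
  fun _ _ huv h => huv.ne h

theorem Coloring.isIndepSetoid_ker {α : Type*} (c : G.Coloring α) :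
    G.IsIndepSetoid (Setoid.ker c) :=
  fun _ _ huv h => c.valid huv h

theorem IsIndepSetoid.colorable [Finite V] {s : Setoid V} (hs : G.IsIndepSetoid s) :
    G.Colorable (Nat.card (Quotient s)) := by
  have := Fintype.ofFinite (Quotient s)
  rw [Nat.card_eq_fintype_card]
  exact (Coloring.mk (Quotient.mk s) fun huv h => hs huv (Quotient.exact h)).colorable

variable (G)

/-- Colorings with kernel the independent setoid `s` are embeddings of the quotient by `s`. -/
noncomputable def coloringKerEqEquivEmbedding (s : Setoid V) (hs : G.IsIndepSetoid s)
    (α : Type*) : {c : G.Coloring α // Setoid.ker c = s} ≃ (Quotient s ↪ α) :=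
  Equiv.trans
    { toFun := fun c => ⟨c.1, c.2⟩
      invFun := fun f => ⟨Coloring.mk f.1 fun {u v} huv h => by
        have h' : Setoid.ker f.1 u v := h
        rw [f.2] at h'
        exact hs huv h', f.2⟩
      left_inv := fun _ => rfl
      right_inv := fun _ => rfl }
    (s.kerEqEquivEmbedding α)

open scoped Classical in
/-- The finite set of independent setoids of `G` with `k` classes. -/
noncomputable def indepSetoids [Fintype V] (k : ℕ) : Finset (Setoid V) :=
  {s | G.IsIndepSetoid s ∧ Nat.card (Quotient s) = k}

variable {G} [Fintype V]

theorem mem_indepSetoids {k : ℕ} {s : Setoid V} :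
    s ∈ G.indepSetoids k ↔ G.IsIndepSetoid s ∧ Nat.card (Quotient s) = k := by
  simp [indepSetoids]

theorem indepSetoids_card : G.indepSetoids (Fintype.card V) = {⊥} := by
  ext s
  rw [mem_indepSetoids, Setoid.natCard_quotient_eq_card_iff, Finset.mem_singleton]
  exact ⟨And.right, fun h => ⟨h ▸ isIndepSetoid_bot, h⟩⟩

theorem card_indepSetoids_le_mul {k n : ℕ} (hn : Fintype.card V = n + 1) (hk : k < n + 1) :
    (G.indepSetoids k).card ≤ (G.indepSetoids n).card * (G.indepSetoids (k + 1)).card := by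
  classical
  refine le_trans (Finset.card_le_card ?_)
    (Finset.card_image₂_le (· ⊔ ·) (G.indepSetoids n) (G.indepSetoids (k + 1)))
  intro s hs
  obtain ⟨hindep, hcard⟩ := mem_indepSetoids.mp hs
  have hbot : s ≠ ⊥ := by
    rw [Ne, ← Setoid.natCard_quotient_eq_card_iff]
    omega
  obtain ⟨p, q, rfl, hp, hq⟩ := Setoid.exists_sup_eq_of_ne_bot hbot
  exact Finset.mem_image₂.mpr ⟨p, mem_indepSetoids.mpr ⟨hindep.mono le_sup_left, by omega⟩,
    q, mem_indepSetoids.mpr ⟨hindep.mono le_sup_right, by omega⟩, rfl⟩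

open scoped Classical in
theorem natCard_coloring (k : ℕ) :
    Nat.card (G.Coloring (Fin k)) =
      ∑ s : {s : Setoid V // G.IsIndepSetoid s}, k.descFactorial (Nat.card (Quotient s.1)) := by
  have e := Equiv.sigmaFiberEquiv
    (fun c : G.Coloring (Fin k) => (⟨Setoid.ker c, c.isIndepSetoid_ker⟩ :
      {s : Setoid V // G.IsIndepSetoid s}))
  have : Finite (G.Coloring (Fin k)) := DFunLike.finite _
  rw [← Nat.card_congr e, Nat.card_sigma]
  refine Finset.sum_congr rfl fun s _ => ?_
  have e' : {c : G.Coloring (Fin k) // (⟨Setoid.ker c, c.isIndepSetoid_ker⟩ :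
      {s : Setoid V // G.IsIndepSetoid s}) = s} ≃ (Quotient s.1 ↪ Fin k) :=
    (Equiv.subtypeEquivRight fun c => Subtype.ext_iff).trans
      (G.coloringKerEqEquivEmbedding s.1 s.2 (Fin k))
  have := Fintype.ofFinite (Quotient s.1)
  rw [Nat.card_congr e', Nat.card_eq_fintype_card, Fintype.card_embedding_eq, Fintype.card_fin,
    Nat.card_eq_fintype_card]

end SimpleGraph

open scoped Classical in
/-- The expansion of the chromatic polynomial in falling factorials. -/
theorem IsChromaticPoly.eq_sum_descPochhammer {V : Type*} [Fintype V] {G : SimpleGraph V}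
    {P : Polynomial ℂ} (hP : IsChromaticPoly G P) {S : Finset ℕ}
    (hS : ∀ s : Setoid V, G.IsIndepSetoid s → Nat.card (Quotient s) ∈ S) :
    P = ∑ k ∈ S, (G.indepSetoids k).card • descPochhammer ℂ k := by
  have hsum : P = ∑ s : {s : Setoid V // G.IsIndepSetoid s},
      descPochhammer ℂ (Nat.card (Quotient s.1)) := by
    refine Polynomial.eq_of_eval_natCast_eq_s4 fun k => ?_
    rw [hP k, SimpleGraph.natCard_coloring, Polynomial.eval_finsetSum]
    push_cast
    exact Finset.sum_congr rfl fun s _ => (descPochhammer_eval_eq_descFactorial ℂ k _).symm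
  rw [hsum, ← Finset.sum_subtype (Finset.univ.filter G.IsIndepSetoid) (by simp)
    (fun s : Setoid V => descPochhammer ℂ (Nat.card (Quotient s))),
    ← Finset.sum_fiberwise_of_maps_to (t := S) (g := fun s : Setoid V => Nat.card (Quotient s))
      (fun s hs => hS s (Finset.mem_filter.mp hs).2)]
  refine Finset.sum_congr rfl fun k _ => ?_
  rw [Finset.filter_filter, Finset.sum_congr rfl fun s hs => by
    rw [(Finset.mem_filter.mp hs).2.2], Finset.sum_const]
  rfl

/-- If `G` is a finite simple graph of order `n` with chromatic number `χ(G) = n - 3`, then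
every chromatic root `z` of `G` satisfies `Re z < n - 1`. -/
theorem chromatic_root_re_lt_of_chromaticNumber_eq_sub_three {V : Type*} [Fintype V]
    (G : SimpleGraph V) (n : ℕ) (hn : n = Fintype.card V)
    (hχ : G.chromaticNumber = ((n - 3 : ℕ) : ℕ∞))
    (P : Polynomial ℂ) (hP : IsChromaticPoly G P) :
    ∀ z : ℂ, P.eval z = 0 → z.re < (n : ℝ) - 1 := by
  intro z hz
  have hcol : G.Colorable (n - 3) := SimpleGraph.chromaticNumber_le_iff_colorable.mp hχ.le
  have hlower : ∀ s : Setoid V, G.IsIndepSetoid s → n - 3 ≤ Nat.card (Quotient s) := by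
    intro s hs
    have h := SimpleGraph.chromaticNumber_le_iff_colorable.mpr hs.colorable
    rw [hχ] at h
    exact_mod_cast h
  rcases lt_or_ge n 3 with hn3 | hn3
  · rw [show n - 3 = 0 by omega] at hcol
    have : IsEmpty V := hcol.some.toFun.isEmpty
    have hone : P = 1 := by
      refine Polynomial.eq_of_eval_natCast_eq_s4 fun k => ?_
      have : Unique (G.Coloring (Fin k)) :=
        ⟨⟨SimpleGraph.Coloring.mk isEmptyElim fun {v} => isEmptyElim v⟩,
          fun c => DFunLike.ext _ _ isEmptyElim⟩
      rw [hP k, Nat.card_unique]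
      simp
    simp [hone] at hz
  · obtain ⟨m, rfl⟩ := Nat.exists_eq_add_of_le' hn3
    simp only [Nat.add_sub_cancel] at hcol hlower
    have hexp := hP.eq_sum_descPochhammer (S := Finset.Ico m (m + 4)) fun s hs =>
      Finset.mem_Ico.mpr ⟨hlower s hs, by have := s.natCard_quotient_le; omega⟩
    have htop : (G.indepSetoids (m + 3)).card = 1 := by
      rw [hn, SimpleGraph.indepSetoids_card, Finset.card_singleton]
    have hle : (G.indepSetoids m).card ≤
        (G.indepSetoids (m + 2)).card * (G.indepSetoids (m + 1)).card :=
      SimpleGraph.card_indepSetoids_le_mul (by omega) (by omega)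
    have hpos : 0 < (G.indepSetoids m).card := by
      refine Finset.card_pos.mpr ⟨Setoid.ker hcol.some,
        SimpleGraph.mem_indepSetoids.mpr ⟨hcol.some.isIndepSetoid_ker, le_antisymm ?_
          (hlower _ hcol.some.isIndepSetoid_ker)⟩⟩
      simpa using Nat.card_le_card_of_injective _ (Setoid.kerLift_injective hcol.some)
    generalize hc : (G.indepSetoids m).card = c at *
    generalize hb : (G.indepSetoids (m + 1)).card = b at *
    generalize ha : (G.indepSetoids (m + 2)).card = a at *
    have hfactor : P.eval z = (descPochhammer ℂ m).eval z *
        ((z - m) * (z - m - 1) * (z - m - 2) + a * ((z - m) * (z - m - 1)) + b * (z - m) + c) := by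
      rw [hexp, Finset.sum_Ico_succ_top (by omega), Finset.sum_Ico_succ_top (by omega),
        Finset.sum_Ico_succ_top (by omega), Finset.sum_Ico_succ_top (by omega), Finset.Ico_self,
        Finset.sum_empty, hc, hb, ha, htop]
      simp only [Polynomial.eval_add, Polynomial.eval_mul, Polynomial.eval_natCast,
        Polynomial.eval_zero, descPochhammer_succ_eval_complex, nsmul_eq_mul]
      push_cast
      ring
    rw [hfactor, mul_eq_zero] at hz
    push_cast
    rcases hz with hz | hz
    · obtain ⟨j, hj, rfl⟩ := exists_natCast_eq_of_descPochhammer_eval_eq_zero hz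
      have : (j : ℝ) < m := by exact_mod_cast hj
      rw [Complex.natCast_re]
      linarith
    · have hle' : (c : ℝ) ≤ a * b := by exact_mod_cast hle
      have hpos' : (0 : ℝ) < c := by exact_mod_cast hpos
      have hre := re_neg_of_cubic_eq_zero (A := a + 3) (B := 3 * a + b + 2)
        (C := 2 * a + 2 * b + c) (y := z - m - 2) (by positivity) (by positivity) (by positivity)
        (by nlinarith [Nat.cast_nonneg (α := ℝ) a, Nat.cast_nonneg (α := ℝ) b])
        (by push_cast; linear_combination hz)
      simp only [Complex.sub_re, Complex.natCast_re, Complex.re_ofNat] at hre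
      linarith
end

section
/- For every finite simple graph F, the following strict inequality holds: 6 + 9·η_F(K_2) + η_F(K_3) + η_F(2K_2) + 3·(η_F(K_2))² + η_F(K_2)·η_F(K_3) + η_F(K_2)·η_F(2K_2) > η_F(K_4) + η_F(K_3 ∪̇ K_2) + η_F(3K_2). -/
open SimpleGraph

/-- `eta G H` is the number of subgraphs of `G` isomorphic to `H`. -/
noncomputable def eta {V W : Type*} (G : SimpleGraph V) (H : SimpleGraph W) : ℕ :=
  Nat.card {G' : G.Subgraph // Nonempty (G'.coe ≃g H)}

section CopyCounts

variable {V W U : Type*}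

/-- Every subgraph isomorphic to `H` is the image of a copy of `H`. -/
lemma exists_copy_toSubgraph_eq {F : SimpleGraph V} {H : SimpleGraph W} {G' : F.Subgraph}
    (h : Nonempty (G'.coe ≃g H)) : ∃ f : Copy H F, f.toSubgraph = G' := by
  have hmem : G' ∈ {B : F.Subgraph | Nonempty (H ≃g B.coe)} := h.map Iso.symm
  rwa [← Copy.range_toSubgraph] at hmem

/-- Every copy of a disjoint sum is the union of a copy of each summand. -/
lemma eta_sum_le [Finite V] (F : SimpleGraph V) (H : SimpleGraph W) (K : SimpleGraph U) :
    eta F (H ⊕g K) ≤ eta F H * eta F K := by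
  have key : ∀ G' : {G' : F.Subgraph // Nonempty (G'.coe ≃g H ⊕g K)},
      ∃ p : {A : F.Subgraph // Nonempty (A.coe ≃g H)} ×
        {B : F.Subgraph // Nonempty (B.coe ≃g K)}, p.1.1 ⊔ p.2.1 = G'.1 := by
    rintro ⟨G', hG'⟩
    obtain ⟨f, rfl⟩ := exists_copy_toSubgraph_eq hG'
    refine ⟨(⟨_, ⟨(f.comp Embedding.sumInl.toCopy).isoToSubgraph.symm⟩⟩,
      ⟨_, ⟨(f.comp Embedding.sumInr.toCopy).isoToSubgraph.symm⟩⟩), ?_⟩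
    ext <;> simp [Copy.toSubgraph, Relation.Map]
  choose p hp using key
  simp only [eta, ← Nat.card_prod]
  refine Nat.card_le_card_of_injective p fun A B hAB => Subtype.ext ?_
  rw [← hp A, ← hp B, hAB]

/-- A subgraph isomorphic to a complete graph is determined by its vertices. -/
lemma adj_iff_of_iso_completeGraph {F : SimpleGraph V} {G' : F.Subgraph}
    (h : Nonempty (G'.coe ≃g completeGraph W)) {a b : V} :
    G'.Adj a b ↔ a ∈ G'.verts ∧ b ∈ G'.verts ∧ a ≠ b := by
  obtain ⟨e⟩ := h
  refine ⟨fun hab => ⟨hab.fst_mem, hab.snd_mem, hab.ne⟩, fun ⟨ha, hb, hab⟩ => ?_⟩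
  have : G'.coe.Adj ⟨a, ha⟩ ⟨b, hb⟩ := by
    rw [← e.map_adj_iff]
    simpa using hab
  exact this

/-- Among graphs on a given number of vertices, complete graphs have the fewest copies. -/
lemma eta_completeGraph_le [Finite V] (F : SimpleGraph V) (H : SimpleGraph U) (e : U ≃ W) :
    eta F (completeGraph W) ≤ eta F H := by
  have key : ∀ G' : {G' : F.Subgraph // Nonempty (G'.coe ≃g completeGraph W)},
      ∃ M : {M : F.Subgraph // Nonempty (M.coe ≃g H)}, M.1.verts = G'.1.verts := by
    rintro ⟨G', hG'⟩
    obtain ⟨f, rfl⟩ := exists_copy_toSubgraph_eq hG'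
    let g : Copy H (completeGraph W) :=
      ⟨⟨e, fun hab => by simpa using hab.ne⟩, e.injective⟩
    refine ⟨⟨_, ⟨(f.comp g).isoToSubgraph.symm⟩⟩, ?_⟩
    have hg : ⇑g = e := rfl
    simp only [Subgraph.map_verts, Subgraph.verts_top, Set.image_univ, Copy.coe_toHom,
      Copy.coe_comp, hg, e.surjective.range_comp]
  choose M hM using key
  refine Nat.card_le_card_of_injective M fun A B hAB => Subtype.ext ?_
  have hverts : A.1.verts = B.1.verts := by rw [← hM A, ← hM B, hAB]
  ext a b
  · rw [hverts]
  · rw [adj_iff_of_iso_completeGraph A.2, adj_iff_of_iso_completeGraph B.2, hverts]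

end CopyCounts

/-- For every finite simple graph `F`:
`6 + 9 η_F(K_2) + η_F(K_3) + η_F(2K_2) + 3 η_F(K_2)² + η_F(K_2) η_F(K_3) + η_F(K_2) η_F(2K_2)`
`> η_F(K_4) + η_F(K_3 ∪̇ K_2) + η_F(3K_2)`. -/
theorem eta_strict_inequality {V : Type*} [Fintype V] (F : SimpleGraph V) :
    eta F (completeGraph (Fin 4))
      + eta F (completeGraph (Fin 3) ⊕g completeGraph (Fin 2))
      + eta F (completeGraph (Fin 2) ⊕g completeGraph (Fin 2) ⊕g completeGraph (Fin 2))
    < 6 + 9 * eta F (completeGraph (Fin 2)) + eta F (completeGraph (Fin 3))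
      + eta F (completeGraph (Fin 2) ⊕g completeGraph (Fin 2))
      + 3 * (eta F (completeGraph (Fin 2))) ^ 2
      + eta F (completeGraph (Fin 2)) * eta F (completeGraph (Fin 3))
      + eta F (completeGraph (Fin 2)) * eta F (completeGraph (Fin 2) ⊕g completeGraph (Fin 2)) := by
  have hK4 : eta F (completeGraph (Fin 4)) ≤ _ :=
    eta_completeGraph_le F (completeGraph (Fin 2) ⊕g completeGraph (Fin 2))
      (finSumFinEquiv (m := 2) (n := 2))
  have hK3K2 := eta_sum_le F (completeGraph (Fin 3)) (completeGraph (Fin 2))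
  have h3K2 := eta_sum_le F (completeGraph (Fin 2) ⊕g completeGraph (Fin 2))
    (completeGraph (Fin 2))
  rw [Nat.mul_comm] at hK3K2 h3K2
  omega
end

section
/- For every integer n ≥ 4, the graph K_n − 2K_2 (the complete graph on n vertices with two vertex-disjoint edges removed) has exactly two non-real chromatic roots, namely z = (2n − 5 ± i√3)/2, and each has real part equal to n − 5/2. -/
/-- The polynomial `(x)_{m + 2} + 2 (x)_{m + 1} + (x)_m`, in factored form. -/
theorem descPochhammer_eval_add_two_mul_add {R : Type*} [CommRing R] (m : ℕ) (x : R) :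
    (descPochhammer R (m + 2)).eval x + 2 * (descPochhammer R (m + 1)).eval x +
        (descPochhammer R m).eval x =
      (descPochhammer R m).eval x * ((x - m) ^ 2 + (x - m) + 1) := by
  simp only [descPochhammer_succ_eval]
  push_cast
  ring

/-- The functions `V → K` with the same fibers as `r` correspond to embeddings of the range
of `r` into `K`. -/
noncomputable def equivRangeEmbedding {V W K : Type*} (r : V → W) :
    {f : V → K // ∀ u v, f u = f v ↔ r u = r v} ≃ (Set.range r ↪ K) where
  toFun f := ⟨fun w => f.1 w.2.choose, fun w w' h => Subtype.ext <| by
    rw [← w.2.choose_spec, ← w'.2.choose_spec]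
    exact (f.2 _ _).1 h⟩
  invFun e := ⟨fun v => e ⟨r v, Set.mem_range_self v⟩, fun u v => by simp⟩
  left_inv f := Subtype.ext <| funext fun v =>
    (f.2 _ _).2 (Set.mem_range_self (f := r) v).choose_spec
  right_inv e := by
    ext w
    exact congrArg e (Subtype.ext w.2.choose_spec)

/-- The number of functions `V → Fin k` with the same fibers as `r`. -/
theorem ncard_setOf_eq_iff {V W : Type*} [Finite V] (r : V → W) (k : ℕ) :
    {f : V → Fin k | ∀ u v, f u = f v ↔ r u = r v}.ncard =
      k.descFactorial (Set.range r).ncard := by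
  classical
  have : Fintype (Set.range r) := Fintype.ofFinite _
  rw [← Nat.card_coe_set_eq, ← Nat.card_coe_set_eq]
  refine (Nat.card_congr (equivRangeEmbedding r)).trans ?_
  rw [Nat.card_eq_fintype_card, Fintype.card_embedding_eq, Fintype.card_fin,
    Nat.card_eq_fintype_card]

theorem range_update_id {V : Type*} [DecidableEq V] {a b : V} (hab : a ≠ b) :
    Set.range (Function.update id a b) = ({a}ᶜ : Set V) := by
  ext v
  simp only [Set.mem_range, Set.mem_compl_iff, Set.mem_singleton_iff, Function.update_apply, id]
  constructor
  · grind
  · intro h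
    exact ⟨v, by grind⟩

/-- The number of colorings of a complete graph with two disjoint edges removed. -/
theorem card_coloring_top_deleteEdges_pair {V : Type*} [Finite V] {a b c d : V}
    (hab : a ≠ b) (hac : a ≠ c) (had : a ≠ d) (hbc : b ≠ c) (hbd : b ≠ d) (hcd : c ≠ d)
    (k : ℕ) :
    Nat.card (((⊤ : SimpleGraph V).deleteEdges {s(a, b), s(c, d)}).Coloring (Fin k)) =
      k.descFactorial (Nat.card V) + 2 * k.descFactorial (Nat.card V - 1) +
        k.descFactorial (Nat.card V - 2) := by
  classical
  have fibers (r : V → V) := ncard_setOf_eq_iff r k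
  have range_both :
      Set.range (Function.update (Function.update id a b) c d) = ({a, c}ᶜ : Set V) := by
    ext v
    simp only [Set.mem_range, Set.mem_compl_iff, Set.mem_insert_iff, Set.mem_singleton_iff,
      Function.update_apply, id]
    constructor
    · grind
    · intro h
      exact ⟨v, by grind⟩
  have h_id := fibers id
  have h_ab := fibers (Function.update id a b)
  have h_cd := fibers (Function.update id c d)
  have h_both := fibers (Function.update (Function.update id a b) c d)
  rw [Set.range_id, Set.ncard_univ] at h_id
  rw [range_update_id hab, Set.ncard_compl, Set.ncard_singleton] at h_ab
  rw [range_update_id hcd, Set.ncard_compl, Set.ncard_singleton] at h_cd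
  rw [range_both, Set.ncard_compl, Set.ncard_pair hac] at h_both
  let S : Set (V → Fin k) :=
    {f | ∀ u v, ((⊤ : SimpleGraph V).deleteEdges {s(a, b), s(c, d)}).Adj u v → f u ≠ f v}
  have card_coloring :
      Nat.card (((⊤ : SimpleGraph V).deleteEdges {s(a, b), s(c, d)}).Coloring (Fin k)) =
        S.ncard := by
    rw [← Nat.card_coe_set_eq]
    exact Nat.card_congr
      { toFun f := ⟨f, fun _ _ h => f.valid h⟩
        invFun f := SimpleGraph.Coloring.mk f.1 fun {_ _} h => f.2 _ _ h
        left_inv _ := rfl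
        right_inv _ := rfl }
  have mem_S (f : V → Fin k) : f ∈ S ↔ ∀ u v, f u = f v →
      u = v ∨ (u = a ∧ v = b ∨ u = b ∧ v = a) ∨ (u = c ∧ v = d ∨ u = d ∧ v = c) := by
    simp only [S, Set.mem_ofPred_eq, SimpleGraph.deleteEdges_adj, SimpleGraph.top_adj,
      Set.mem_insert_iff, Set.mem_singleton_iff, Sym2.eq_iff]
    exact forall₂_congr fun u v => by tauto
  rw [card_coloring, ← Set.ncard_inter_add_ncard_sdiff_eq_ncard S {f | f a = f b},
    ← Set.ncard_inter_add_ncard_sdiff_eq_ncard (S ∩ _) {f | f c = f d},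
    ← Set.ncard_inter_add_ncard_sdiff_eq_ncard (S \ _) {f | f c = f d},
    ← h_id, two_mul]
  nth_rw 1 [← h_ab]
  rw [← h_cd, ← h_both]
  have e_both : S ∩ {f | f a = f b} ∩ {f | f c = f d} = {f | ∀ u v, f u = f v ↔
      Function.update (Function.update id a b) c d u =
        Function.update (Function.update id a b) c d v} := by
    ext f
    simp only [Set.mem_inter_iff, mem_S, Set.mem_ofPred_eq, Function.update_apply, id]
    constructor
    · grind
    · intro h
      refine ⟨⟨fun u v => ?_, ?_⟩, ?_⟩ <;> rw [h] <;> grind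
  have e_ab : (S ∩ {f | f a = f b}) \ {f | f c = f d} = {f | ∀ u v, f u = f v ↔
      Function.update id a b u = Function.update id a b v} := by
    ext f
    simp only [Set.mem_inter_iff, Set.mem_sdiff, mem_S, Set.mem_ofPred_eq, Function.update_apply, id]
    constructor
    · grind
    · intro h
      refine ⟨⟨fun u v => ?_, ?_⟩, ?_⟩ <;> rw [h] <;> grind
  have e_cd : (S \ {f | f a = f b}) ∩ {f | f c = f d} = {f | ∀ u v, f u = f v ↔
      Function.update id c d u = Function.update id c d v} := by
    ext f
    simp only [Set.mem_inter_iff, Set.mem_sdiff, mem_S, Set.mem_ofPred_eq, Function.update_apply, id]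
    constructor
    · grind
    · intro h
      refine ⟨⟨fun u v => ?_, ?_⟩, ?_⟩ <;> rw [h] <;> grind
  have e_id : (S \ {f | f a = f b}) \ {f | f c = f d} = {f | ∀ u v, f u = f v ↔
      id u = id v} := by
    ext f
    simp only [Set.mem_sdiff, mem_S, Set.mem_ofPred_eq, id]
    grind
  rw [e_both, e_ab, e_cd, e_id]
  omega

/-- A polynomial counting the colorings of the complete graph on `m + 2` vertices with two
disjoint edges removed, in factored form. -/
theorem IsChromaticPoly.eval_eq_of_top_deleteEdges_pair {V : Type*} [Finite V] {a b c d : V}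
    (hab : a ≠ b) (hac : a ≠ c) (had : a ≠ d) (hbc : b ≠ c) (hbd : b ≠ d) (hcd : c ≠ d)
    {m : ℕ} (hm : Nat.card V = m + 2) {P : Polynomial ℂ}
    (hP : IsChromaticPoly ((⊤ : SimpleGraph V).deleteEdges {s(a, b), s(c, d)}) P) (z : ℂ) :
    P.eval z = (∏ j ∈ Finset.range m, (z - j)) * ((z - m) ^ 2 + (z - m) + 1) := by
  have hPQ : P = descPochhammer ℂ (m + 2) + 2 * descPochhammer ℂ (m + 1) +
      descPochhammer ℂ m := by
    refine Polynomial.eq_of_infinite_eval_eq _ _ <|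
      (Set.infinite_range_of_injective (Nat.cast_injective (R := ℂ))).mono ?_
    rintro _ ⟨k, rfl⟩
    have h := hP k
    rw [card_coloring_top_deleteEdges_pair hab hac had hbc hbd hcd, hm] at h
    simp [h, descPochhammer_eval_eq_descFactorial]
  rw [hPQ, ← descPochhammer_eval_eq_prod_range, ← descPochhammer_eval_add_two_mul_add]
  simp

/-- The roots of `x ^ 2 + x + 1`, shifted by `n - 2`. -/
theorem sub_sq_add_sub_add_one_eq_zero_iff (n z : ℂ) :
    (z - (n - 2)) ^ 2 + (z - (n - 2)) + 1 = 0 ↔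
      z = ((2 * n - 5) + Complex.I * (Real.sqrt 3 : ℂ)) / 2 ∨
        z = ((2 * n - 5) - Complex.I * (Real.sqrt 3 : ℂ)) / 2 := by
  have h3 : (Real.sqrt 3 : ℂ) ^ 2 = 3 := by
    rw [← Complex.ofReal_pow, Real.sq_sqrt (by norm_num)]
    norm_num
  have factor : (z - (n - 2)) ^ 2 + (z - (n - 2)) + 1 =
      (z - ((2 * n - 5) + Complex.I * (Real.sqrt 3 : ℂ)) / 2) *
        (z - ((2 * n - 5) - Complex.I * (Real.sqrt 3 : ℂ)) / 2) := by
    linear_combination ((Real.sqrt 3 : ℂ) ^ 2 / 4) * Complex.I_sq - h3 / 4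
  rw [factor, mul_eq_zero, sub_eq_zero, sub_eq_zero]

/-- For every integer `n ≥ 4`, the graph `K_n - 2K_2` (the complete graph on `n` vertices with
two vertex-disjoint edges removed) has exactly two non-real chromatic roots, namely
`z = (2n - 5 ± i√3)/2`, and each has real part equal to `n - 5/2`. -/
theorem nonreal_chromatic_roots_of_completeGraph_sub_two_edges (n : ℕ) (hn : 4 ≤ n)
    (G : SimpleGraph (Fin n))
    (hG : G = (⊤ : SimpleGraph (Fin n)).deleteEdges
      {s((⟨0, by omega⟩ : Fin n), (⟨1, by omega⟩ : Fin n)),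
       s((⟨2, by omega⟩ : Fin n), (⟨3, by omega⟩ : Fin n))})
    (P : Polynomial ℂ) (hP : IsChromaticPoly G P) :
    (∀ z : ℂ, (P.eval z = 0 ∧ z.im ≠ 0) ↔
        (z = ((2 * n - 5 : ℂ) + Complex.I * (Real.sqrt 3 : ℂ)) / 2 ∨
          z = ((2 * n - 5 : ℂ) - Complex.I * (Real.sqrt 3 : ℂ)) / 2)) ∧
      (((2 * n - 5 : ℂ) + Complex.I * (Real.sqrt 3 : ℂ)) / 2).re = (n : ℝ) - 5 / 2 ∧
      (((2 * n - 5 : ℂ) - Complex.I * (Real.sqrt 3 : ℂ)) / 2).re = (n : ℝ) - 5 / 2 := by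
  subst hG
  obtain ⟨m, rfl⟩ : ∃ m, n = m + 2 := ⟨n - 2, by omega⟩
  have heval := hP.eval_eq_of_top_deleteEdges_pair (by simp) (by simp) (by simp) (by simp)
    (by simp) (by simp) (Nat.card_fin _)
  refine ⟨fun z => ?_, by simp; ring, by simp; ring⟩
  have hquad := sub_sq_add_sub_add_one_eq_zero_iff ((m + 2 : ℕ) : ℂ) z
  rw [show ((m + 2 : ℕ) : ℂ) - 2 = m by push_cast; ring] at hquad
  rw [heval, ← hquad, mul_eq_zero, Finset.prod_eq_zero_iff]
  constructor
  · rintro ⟨⟨j, -, hj⟩ | hz, him⟩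
    · exact absurd (by simp [sub_eq_zero.1 hj]) him
    · exact hz
  · refine fun hz => ⟨Or.inr hz, ?_⟩
    rcases hquad.1 hz with rfl | rfl <;> simp
end

section
/- Let G be a finite simple graph of order n and size m with girth g (G contains a cycle), and write π(G,x) = Σ_{i=1}^{n} (−1)^{n−i} h_i x^i. Then for every integer i with 0 ≤ i ≤ g − 2, one has h_{n−i} = C(m, i); equivalently, the coefficient of x^{n−i} in π(G,x) equals (−1)^i C(m,i) for 0 ≤ i ≤ g − 2. -/
open Polynomial

namespace SimpleGraph

variable {V : Type*}

/-- Functions on the vertices that agree along edges are functions on the connected components. -/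
def ConnectedComponent.liftEquiv (G : SimpleGraph V) (α : Type*) :
    {f : V → α // ∀ a b, G.Adj a b → f a = f b} ≃ (G.ConnectedComponent → α) where
  toFun f := ConnectedComponent.lift f.1 fun _ _ p hp ↦ by
    clear hp
    induction p with
    | nil => rfl
    | cons hadj _ ih => exact (f.2 _ _ hadj).trans ih
  invFun F := ⟨fun v ↦ F (G.connectedComponentMk v), fun _ _ hadj ↦
    congrArg F (ConnectedComponent.sound hadj.reachable)⟩
  left_inv _ := rfl
  right_inv F := by
    funext c
    induction c using ConnectedComponent.ind with
    | h v => rfl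

/-- Deleting a bridge creates exactly one new connected component. -/
theorem IsBridge.card_connectedComponent_deleteEdges [Finite V] {G : SimpleGraph V} {u v : V}
    (hadj : G.Adj u v) (hb : G.IsBridge s(u, v)) :
    Nat.card (G.deleteEdges {s(u, v)}).ConnectedComponent =
      Nat.card G.ConnectedComponent + 1 := by
  classical
  set H := G.deleteEdges {s(u, v)} with hH
  have huv : H.connectedComponentMk v ≠ H.connectedComponentMk u := fun h ↦
    (isBridge_iff.1 hb) (ConnectedComponent.exact h).symm
  have hle : H ≤ G := deleteEdges_le _
  let f : V → H.ConnectedComponent := fun w ↦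
    if H.connectedComponentMk w = H.connectedComponentMk u then H.connectedComponentMk v
    else H.connectedComponentMk w
  have hf : ∀ a b, G.Adj a b → f a = f b := by
    intro a b hab
    by_cases he : s(a, b) = s(u, v)
    · rcases Sym2.eq_iff.1 he with ⟨rfl, rfl⟩ | ⟨rfl, rfl⟩ <;> simp [f]
    · have : H.connectedComponentMk a = H.connectedComponentMk b :=
        ConnectedComponent.sound (Adj.reachable (by simp [hH, hab, he]))
      simp only [f, this]
  let F := ConnectedComponent.liftEquiv G _ ⟨f, hf⟩
  have hbij : Function.Bijective
      (fun c : {c : H.ConnectedComponent // c ≠ H.connectedComponentMk u} ↦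
        c.1.map (Hom.ofLE hle)) := by
    constructor
    · rintro ⟨c, hc⟩ ⟨d, hd⟩ hcd
      induction c using ConnectedComponent.ind with | h a
      induction d using ConnectedComponent.ind with | h b
      have h : f a = f b := congrArg F hcd
      simp only [f, if_neg hc, if_neg hd] at h
      exact Subtype.ext h
    · intro c
      induction c using ConnectedComponent.ind with | h a
      by_cases ha : H.connectedComponentMk a = H.connectedComponentMk u
      · refine ⟨⟨_, huv⟩, ConnectedComponent.sound ?_⟩
        exact hadj.symm.reachable.trans ((ConnectedComponent.exact ha).mono hle).symm
      · exact ⟨⟨_, ha⟩, rfl⟩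
  have := Fintype.ofFinite H.ConnectedComponent
  rw [← Nat.card_congr (Equiv.ofBijective _ hbij), Nat.card_eq_fintype_card,
    Nat.card_eq_fintype_card, Fintype.card_subtype_compl, Fintype.card_subtype_eq,
    Nat.sub_add_cancel (Fintype.card_pos_iff.2 ⟨H.connectedComponentMk u⟩)]

theorem IsAcyclic.card_connectedComponent_add_card_edgeSet [Finite V] {G : SimpleGraph V}
    (hG : G.IsAcyclic) :
    Nat.card G.ConnectedComponent + Nat.card G.edgeSet = Nat.card V := by
  induction hk : Nat.card G.edgeSet generalizing G with
  | zero =>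
    have : G = ⊥ := by
      rw [← edgeSet_eq_empty, ← Set.isEmpty_coe_sort]
      exact (Finite.card_eq_zero_iff).1 hk
    subst this
    refine (Nat.card_eq_of_bijective (connectedComponentMk ⊥) ⟨fun a b h ↦ ?_, ?_⟩).symm
    · simpa using h
    · exact fun c ↦ c.exists_rep
  | succ k ih =>
    obtain ⟨⟨e, he⟩⟩ : Nonempty G.edgeSet := (Nat.card_pos_iff.1 (by omega)).1
    induction e with | h u v
    have hb := isAcyclic_iff_forall_isBridge.1 hG he
    have hcard : Nat.card (G.deleteEdges {s(u, v)}).edgeSet = k := by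
      rw [edgeSet_deleteEdges, Nat.card_coe_set_eq, Set.ncard_sdiff_singleton_of_mem he,
        ← Nat.card_coe_set_eq, hk, Nat.add_sub_cancel]
    have := ih (hG.anti (deleteEdges_le _)) hcard
    rw [IsBridge.card_connectedComponent_deleteEdges he hb] at this
    omega

/-- Whitney's subgraph expansion of the number of proper colorings. -/
theorem card_coloring_eq_sum_powerset [Finite V] (G : SimpleGraph V) [Fintype G.edgeSet]
    (α R : Type*) [Finite α] [CommRing R] :
    (Nat.card (G.Coloring α) : R) = ∑ S ∈ G.edgeFinset.powerset, (-1) ^ S.card *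
      (Nat.card α : R) ^ Nat.card (fromEdgeSet (S : Set (Sym2 V))).ConnectedComponent := by
  classical
  have := Fintype.ofFinite V
  have := Fintype.ofFinite α
  have hcol : Nat.card (G.Coloring α) =
      Nat.card {f : V → α // ∀ e ∈ G.edgeFinset, ¬ (e.map f).IsDiag} := by
    refine Nat.card_congr ⟨fun c ↦ ⟨c, ?_⟩, fun f ↦ Coloring.mk f.1 ?_, fun _ ↦ rfl, fun _ ↦ rfl⟩
    · intro e he
      induction e with | h a b
      simpa using c.valid (mem_edgeFinset.1 he)
    · intro a b hab
      simpa using f.2 s(a, b) (mem_edgeFinset.2 hab)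
  have hmono (S : Finset (Sym2 V)) : Nat.card {f : V → α // ∀ e ∈ S, (e.map f).IsDiag} =
      Nat.card α ^ Nat.card (fromEdgeSet (S : Set (Sym2 V))).ConnectedComponent := by
    rw [← Nat.card_fun, ← Nat.card_congr (ConnectedComponent.liftEquiv _ α)]
    refine Nat.card_congr (Equiv.subtypeEquivRight fun f ↦ ⟨fun h a b hab ↦ ?_, fun h e he ↦ ?_⟩)
    · simpa using h s(a, b) (by simpa using hab.1)
    · induction e with | h a b
      by_cases hab : a = b
      · simp [hab]
      · simpa using h a b (by simpa [hab] using he)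
  simp_rw [← Nat.cast_pow, ← hmono, hcol, Nat.card_eq_fintype_card, Fintype.card_subtype,
    Finset.card_filter, Nat.cast_sum, Finset.mul_sum]
  rw [Finset.sum_comm]
  refine Finset.sum_congr rfl fun f _ ↦ ?_
  calc _ = ∏ e ∈ G.edgeFinset, (1 + -(if (e.map f).IsDiag then 1 else 0 : R)) := by
        trans ∏ e ∈ G.edgeFinset, if ¬ (e.map f).IsDiag then (1 : R) else 0
        · rw [Finset.prod_boole, Nat.cast_ite, Nat.cast_one, Nat.cast_zero]
          congr
        refine Finset.prod_congr rfl fun e _ ↦ ?_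
        split_ifs <;> simp_all
    _ = _ := by
        rw [Finset.prod_one_add]
        refine Finset.sum_congr rfl fun S _ ↦ ?_
        rw [Finset.prod_neg, Finset.prod_boole, Nat.cast_ite, Nat.cast_one, Nat.cast_zero]
        congr

theorem card_connectedComponent_anti [Finite V] {G H : SimpleGraph V} (h : G ≤ H) :
    Nat.card H.ConnectedComponent ≤ Nat.card G.ConnectedComponent :=
  Nat.card_le_card_of_surjective _ (ConnectedComponent.surjective_map_ofLE h)

theorem isAcyclic_fromEdgeSet_of_card_lt_egirth {G : SimpleGraph V} {S : Finset (Sym2 V)}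
    (hS : (S : Set (Sym2 V)) ⊆ G.edgeSet) (hcard : (S.card : ℕ∞) < G.egirth) :
    (fromEdgeSet (S : Set (Sym2 V))).IsAcyclic := by
  classical
  intro a w hw
  have hle : fromEdgeSet (S : Set (Sym2 V)) ≤ G := (fromEdgeSet_mono hS).trans_eq (by simp)
  have hlen : w.length ≤ S.card := by
    rw [← w.length_edges, ← List.toFinset_card_of_nodup hw.edges_nodup]
    refine Finset.card_le_card fun e he ↦ ?_
    have := w.edges_subset_edgeSet (List.mem_toFinset.1 he)
    rw [edgeSet_fromEdgeSet] at this
    exact this.1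
  have := egirth_le_length (hw.mapLe hle)
  rw [Walk.length_mapLe] at this
  exact absurd (this.trans (Nat.cast_le.2 hlen)) hcard.not_ge

theorem card_connectedComponent_fromEdgeSet_add_card [Finite V] {G : SimpleGraph V}
    {S : Finset (Sym2 V)} (hS : (S : Set (Sym2 V)) ⊆ G.edgeSet)
    (hcard : (S.card : ℕ∞) < G.egirth) :
    Nat.card (fromEdgeSet (S : Set (Sym2 V))).ConnectedComponent + S.card = Nat.card V := by
  have hE : (fromEdgeSet (S : Set (Sym2 V))).edgeSet = S := by
    rw [edgeSet_fromEdgeSet, sdiff_eq_left, Set.disjoint_left]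
    exact fun e he ↦ G.not_isDiag_of_mem_edgeSet (hS he)
  have := (isAcyclic_fromEdgeSet_of_card_lt_egirth hS hcard).card_connectedComponent_add_card_edgeSet
  rwa [hE, Nat.card_coe_set_eq, Set.ncard_coe_finset] at this

theorem card_connectedComponent_fromEdgeSet_eq_iff [Finite V] {G : SimpleGraph V}
    {S : Finset (Sym2 V)} (hS : (S : Set (Sym2 V)) ⊆ G.edgeSet) {g i : ℕ}
    (hg : G.egirth = g) (hi : i + 2 ≤ g) (hgV : g ≤ Nat.card V) :
    Nat.card V - i = Nat.card (fromEdgeSet (S : Set (Sym2 V))).ConnectedComponent ↔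
      S.card = i := by
  rcases lt_or_ge S.card g with hlt | hge
  · have := card_connectedComponent_fromEdgeSet_add_card hS (by rw [hg]; exact_mod_cast hlt)
    omega
  · obtain ⟨T, hTS, hT⟩ := Finset.exists_subset_card_eq (show g - 1 ≤ S.card by omega)
    have hTS' : (T : Set (Sym2 V)) ⊆ S := Finset.coe_subset.2 hTS
    have h₁ := card_connectedComponent_fromEdgeSet_add_card (hTS'.trans hS)
      (by rw [hg, hT]; exact_mod_cast (by omega : g - 1 < g))
    have h₂ := card_connectedComponent_anti (fromEdgeSet_mono hTS')
    omega

theorem egirth_le_card [Finite V] {G : SimpleGraph V} (hG : ¬ G.IsAcyclic) :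
    G.egirth ≤ Nat.card V := by
  obtain ⟨a, w, hw, hlen⟩ := exists_egirth_eq_length.2 hG
  have := Fintype.ofFinite V
  have h := hw.support_nodup.length_le_card
  rw [List.length_tail, Walk.length_support, Nat.add_sub_cancel] at h
  rw [hlen, Nat.card_eq_fintype_card]
  exact_mod_cast h

end SimpleGraph

open SimpleGraph in
theorem IsChromaticPoly.eq_sum_powerset {V : Type*} [Finite V] {G : SimpleGraph V}
    [Fintype G.edgeSet] {P : Polynomial ℂ} (hP : IsChromaticPoly G P) :
    P = ∑ S ∈ G.edgeFinset.powerset, C ((-1 : ℂ) ^ S.card) *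
      X ^ Nat.card (fromEdgeSet (S : Set (Sym2 V))).ConnectedComponent := by
  refine Polynomial.eq_of_infinite_eval_eq _ _
    ((Set.infinite_range_of_injective (Nat.cast_injective (R := ℂ))).mono ?_)
  rintro _ ⟨k, rfl⟩
  have := card_coloring_eq_sum_powerset G (Fin k) ℂ
  rw [Nat.card_fin] at this
  simp only [Set.mem_ofPred_eq, hP k, this, eval_finsetSum, eval_mul, eval_C, eval_pow, eval_X]

/-- Let `G` be a finite simple graph of order `n`, size `m` and (finite) girth `g`, and write
`π(G,x) = ∑_{i=1}^{n} (-1)^{n-i} h_i x^i`. Then for `0 ≤ i ≤ g - 2` one has `h_{n-i} = C(m,i)`;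
equivalently, the coefficient of `x^{n-i}` in `π(G,x)` equals `(-1)^i C(m,i)`. -/
theorem chromatic_coeff_eq_choose_of_le_girth_sub_two {V : Type*} [Fintype V]
    (G : SimpleGraph V) (n m g : ℕ)
    (hn : n = Fintype.card V) (hm : m = Nat.card G.edgeSet) (hg : G.egirth = (g : ℕ∞))
    (P : Polynomial ℂ) (hP : IsChromaticPoly G P)
    (h : ℕ → ℂ)
    (hh : P = ∑ i ∈ Finset.Icc 1 n, C ((-1 : ℂ) ^ (n - i)) * C (h i) * X ^ i)
    (i : ℕ) (hi : i ≤ g - 2) :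
    h (n - i) = (m.choose i : ℂ) ∧ P.coeff (n - i) = (-1 : ℂ) ^ i * (m.choose i : ℂ) := by
  classical
  have hn' : n = Nat.card V := hn.trans Nat.card_eq_fintype_card.symm
  have hg3 : 3 ≤ g := by exact_mod_cast hg ▸ G.three_le_egirth
  have hcyc : ¬ G.IsAcyclic := fun hG ↦ by simp [hG.egirth_eq_top] at hg
  have hgn : g ≤ n := by
    have := SimpleGraph.egirth_le_card hcyc
    rw [hg, ← hn'] at this
    exact_mod_cast this
  have hcoeff : P.coeff (n - i) = (-1 : ℂ) ^ i * (m.choose i : ℂ) := by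
    have hfilter : G.edgeFinset.powerset.filter (fun S : Finset (Sym2 V) ↦ n - i = Nat.card
        (SimpleGraph.fromEdgeSet (S : Set (Sym2 V))).ConnectedComponent) =
        G.edgeFinset.powersetCard i := by
      rw [Finset.powersetCard_eq_filter]
      refine Finset.filter_congr fun S hS ↦ ?_
      rw [hn']
      refine SimpleGraph.card_connectedComponent_fromEdgeSet_eq_iff (fun e he ↦ ?_) hg
        (by omega) (by omega)
      exact SimpleGraph.mem_edgeFinset.1 (Finset.mem_powerset.1 hS he)
    rw [hP.eq_sum_powerset]
    simp only [finsetSum_coeff, coeff_C_mul, coeff_X_pow, mul_ite, mul_one, mul_zero]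
    rw [← Finset.sum_filter, hfilter, Finset.sum_congr rfl fun S hS ↦ by
      rw [(Finset.mem_powersetCard.1 hS).2], Finset.sum_const, Finset.card_powersetCard,
      SimpleGraph.edgeFinset_card, ← Nat.card_eq_fintype_card, ← hm, nsmul_eq_mul, mul_comm]
  refine ⟨?_, hcoeff⟩
  have hcoeff' : P.coeff (n - i) = (-1 : ℂ) ^ i * h (n - i) := by
    rw [hh]
    simp only [finsetSum_coeff, mul_assoc, coeff_C_mul, coeff_X_pow, mul_ite, mul_one, mul_zero]
    rw [Finset.sum_ite_eq, if_pos (Finset.mem_Icc.2 (by omega)), show n - (n - i) = i by omega]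
  exact mul_left_cancel₀ (pow_ne_zero i (neg_ne_zero.2 one_ne_zero)) (hcoeff'.symm.trans hcoeff)
end
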